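/- Let n ≥ 1, let Ω be an n×n real positive semidefinite matrix with trace(Ω) > 0 and positive semidefinite square root S, let v ∈ ℝⁿ be a unit vector, and set Q := S·(I − v·vᵀ)·S. Let γ ∈ (0, 1), let Δ be a real number, and set Θ := 1 − (vᵀΩv)/trace(Ω) + Δ. Assume Δ ≥ (2·‖Q − Θ·Ω‖_F·√(log(1/γ)) + 2·‖Q − Θ·Ω‖₂·log(1/γ)) / trace(Ω), where ‖·‖_F is the Frobenius norm and ‖·‖₂ the spectral norm. Let s be a standard Gaussian random vector on ℝⁿ (i.e., with n independent N(0,1) coordinates). Then with probability at least 1 − γ: sᵀ·Q·s ≤ Θ · (sᵀ·Ω·s). -/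

import Mathlib

open Matrix MeasureTheory ProbabilityTheory

/-- The Frobenius norm of a real matrix. -/
noncomputable def frobNorm {n : ℕ} (M : Matrix (Fin n) (Fin n) ℝ) : ℝ :=
  Real.sqrt (∑ i, ∑ j, M i j ^ 2)

/-- The spectral (ℓ²-operator) norm of a real matrix. -/
noncomputable def specNorm {n : ℕ} (M : Matrix (Fin n) (Fin n) ℝ) : ℝ :=
  ‖Matrix.toEuclideanCLM (𝕜 := ℝ) M‖

lemma aux_log (c y : ℝ) (hc : c < 1) (hy : |y| ≤ c) :
    -Real.log (1 - y) ≤ y + y ^ 2 / (2 * (1 - c)) := by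
  have h1 := (abs_le.mp hy).1
  have h2 := (abs_le.mp hy).2
  have hc0 : 0 ≤ c := (abs_nonneg y).trans hy
  rcases le_total 0 y with h | h
  · have hp : 0 < 1 - y := by linarith
    have hu : 0 ≤ Real.log (1 - y)⁻¹ :=
      Real.log_nonneg ((one_le_inv₀ hp).mpr (by linarith))
    have := Real.self_le_sinh_iff.mpr hu
    rw [Real.sinh_log (inv_pos.mpr hp), Real.log_inv, inv_inv] at this
    refine this.trans ?_
    have e : ((1 - y)⁻¹ - (1 - y)) / 2 = y + y ^ 2 / (2 * (1 - y)) := by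
      field_simp; ring
    rw [e]
    gcongr
  · have := Real.le_log_one_add_of_nonneg (x := -y) (by linarith)
    have e : 1 + -y = 1 - y := by ring
    rw [e] at this
    have h3 : y ^ 2 / 2 ≤ y ^ 2 / (2 * (1 - c)) := by
      apply div_le_div_of_nonneg_left (by positivity) (by linarith) (by linarith)
    have h4 : -y - y ^ 2 / 2 ≤ 2 * (-y) / (-y + 2) := by
      rw [le_div_iff₀ (by linarith)]
      nlinarith [mul_nonneg (sq_nonneg y) (neg_nonneg.mpr h)]
    linarith

lemma aux_integrable (a : ℝ) (ha : a < 1 / 2) :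
    Integrable (fun x : ℝ => Real.exp (a * x ^ 2)) (gaussianReal 0 1) ∧
    ∫ x, Real.exp (a * x ^ 2) ∂(gaussianReal 0 1) = (Real.sqrt (1 - 2 * a))⁻¹ := by
  have key : ∀ x : ℝ, gaussianPDFReal 0 1 x • Real.exp (a * x ^ 2) =
      (Real.sqrt (2 * Real.pi))⁻¹ * Real.exp (-(1 / 2 - a) * x ^ 2) := by
    intro x
    simp only [gaussianPDFReal, smul_eq_mul, NNReal.coe_one, mul_one, sub_zero]
    rw [mul_assoc, ← Real.exp_add]
    congr 2
    ring
  constructor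
  · rw [gaussianReal_of_var_ne_zero _ (by norm_num)]
    rw [integrable_withDensity_iff_integrable_smul' (measurable_gaussianPDF _ _)
      (by simp [gaussianPDF])]
    simp only [toReal_gaussianPDF, key]
    exact (integrable_exp_neg_mul_sq (by linarith)).const_mul _
  · rw [integral_gaussianReal_eq_integral_smul (by norm_num)]
    simp only [key]
    rw [integral_const_mul, integral_gaussian, ← Real.sqrt_inv, ← Real.sqrt_inv,
      ← Real.sqrt_mul (by positivity)]
    congr 1
    have : (1 - 2 * a) ≠ 0 := by linarith
    have : (1 / 2 - a) ≠ 0 := by linarith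
    have := Real.pi_ne_zero
    field_simp

lemma aux_mgf (a c : ℝ) (hc : 2 * c < 1) (ha : |a| ≤ c) :
    (Real.sqrt (1 - 2 * a))⁻¹ ≤ Real.exp (a + a ^ 2 / (1 - 2 * c)) := by
  have h2 := (abs_le.mp ha).2
  have hp : 0 < 1 - 2 * a := by linarith
  have := aux_log (2 * c) (2 * a) hc (by rw [abs_mul]; norm_num; exact ha)
  have hs : 0 < Real.sqrt (1 - 2 * a) := Real.sqrt_pos.mpr hp
  rw [← Real.log_le_iff_le_exp (inv_pos.mpr hs), Real.log_inv, Real.log_sqrt hp.le]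
  have e : (2 * a) ^ 2 / (2 * (1 - 2 * c)) = 2 * (a ^ 2 / (1 - 2 * c)) := by
    have : 1 - 2 * c ≠ 0 := by linarith
    field_simp; 
  rw [e] at this
  linarith

lemma aux_rot {n : ℕ} (b : OrthonormalBasis (Fin n) ℝ (EuclideanSpace ℝ (Fin n))) :
    (Measure.pi fun _ : Fin n => gaussianReal 0 1).map
      (fun x : Fin n → ℝ => WithLp.ofLp (∑ i, x i • b i)) =
    (Measure.pi fun _ : Fin n => gaussianReal 0 1) := by
  have h := (map_pi_eq_stdGaussian (ι := Fin n)).trans (stdGaussian_eq_map_pi_orthonormalBasis b)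
  have h2 := congrArg (fun μ => μ.map (WithLp.ofLp : EuclideanSpace ℝ (Fin n) → _)) h
  simp only at h2
  rw [Measure.map_map (by fun_prop) (by fun_prop), Measure.map_map (by fun_prop) (by fun_prop)] at h2
  have e : (WithLp.ofLp : EuclideanSpace ℝ (Fin n) → _) ∘ (WithLp.toLp 2) = id := by
    ext; rfl
  rw [e, Measure.map_id] at h2
  exact h2.symm

lemma aux_chernoff {α : Type*} [MeasurableSpace α] (μ : Measure α) [IsFiniteMeasure μ]
    (X : α → ℝ) (l c : ℝ) (hl0 : 0 < l) (hint : Integrable (fun x => Real.exp (l * X x)) μ)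
    (hmgf : ∫ x, Real.exp (l * X x) ∂μ ≤ c) :
    μ {x | 0 < X x} ≤ ENNReal.ofReal c := by
  have hch := measure_ge_le_exp_mul_mgf (μ := μ) (X := X) 0 hl0.le hint
  rw [mul_zero, Real.exp_zero, one_mul] at hch
  have hc : μ.real {x | 0 < X x} ≤ c := by
    refine le_trans (measureReal_mono ?_ (measure_ne_top _ _)) (hch.trans hmgf)
    intro x hx
    simp only [Set.mem_ofPred_eq] at hx ⊢
    exact hx.le
  exact (ENNReal.le_ofReal_iff_toReal_le (measure_ne_top _ _)
    (measureReal_nonneg.trans hc)).mpr hc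

/-- Chernoff bound for a diagonal Gaussian quadratic form. -/
lemma aux_diag {n : ℕ} (d : Fin n → ℝ) (F K t : ℝ) (ht : 0 < t) (hF : 0 ≤ F) (hK : 0 ≤ K)
    (hdK : ∀ i, |d i| ≤ K) (hdF : ∑ i, d i ^ 2 = F ^ 2)
    (htr : ∑ i, d i ≤ -(2 * F * Real.sqrt t + 2 * K * t)) :
    (Measure.pi fun _ : Fin n => gaussianReal 0 1) {x | 0 < ∑ i, d i * x i ^ 2} ≤
      ENNReal.ofReal (Real.exp (-t)) := by
  rcases hF.eq_or_lt with h0 | hF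
  · have hz : ∀ i, d i = 0 := by
      intro i
      rw [← h0] at hdF
      have := (Finset.sum_eq_zero_iff_of_nonneg (fun i _ => sq_nonneg (d i))).mp
        (by simpa using hdF) i (Finset.mem_univ i)
      simpa using this
    simp [hz]
  have hr0' : 0 < Real.sqrt t := Real.sqrt_pos.mpr ht
  have hrt' : t = Real.sqrt t ^ 2 := (Real.sq_sqrt ht.le).symm
  generalize Real.sqrt t = r at htr hr0' hrt'
  have hr0 := hr0'
  have hrt := hrt'
  have hD : 0 < F + 2 * K * r := by positivity
  obtain ⟨l, hl⟩ : ∃ l, l = r / (F + 2 * K * r) := ⟨_, rfl⟩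
  have hl0 : 0 < l := by rw [hl]; positivity
  have hlK : 1 - 2 * (l * K) = F / (F + 2 * K * r) := by rw [hl]; field_simp; ring
  have hlK0 : 2 * (l * K) < 1 := by
    have : 0 < F / (F + 2 * K * r) := by positivity
    linarith
  have habs : ∀ i, |l * d i| ≤ l * K := by
    intro i
    rw [abs_mul, abs_of_pos hl0]
    exact mul_le_mul_of_nonneg_left (hdK i) hl0.le
  have hlt : ∀ i, l * d i < 1 / 2 := fun i => by
    have := (abs_le.mp (habs i)).2
    linarith
  have hprod : ∀ x : Fin n → ℝ, Real.exp (l * ∑ i, d i * x i ^ 2) =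
      ∏ i, Real.exp (l * d i * x i ^ 2) := by
    intro x
    rw [← Real.exp_sum, Finset.mul_sum]
    simp only [mul_assoc]
  have hint : Integrable (fun x : Fin n → ℝ => Real.exp (l * ∑ i, d i * x i ^ 2))
      (Measure.pi fun _ : Fin n => gaussianReal 0 1) := by
    simp only [hprod]
    exact Integrable.fintype_prod (f := fun i x => Real.exp (l * d i * x ^ 2))
      (fun i => (aux_integrable _ (hlt i)).1)
  have hmgf : ∫ x : Fin n → ℝ, Real.exp (l * ∑ i, d i * x i ^ 2)
      ∂(Measure.pi fun _ : Fin n => gaussianReal 0 1) ≤ Real.exp (-t) := by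
    simp only [hprod]
    rw [integral_fintype_prod_eq_prod (f := fun i x => Real.exp (l * d i * x ^ 2))]
    calc _ ≤ ∏ i, Real.exp (l * d i + (l * d i) ^ 2 / (1 - 2 * (l * K))) := by
          apply Finset.prod_le_prod
          · intro i _
            exact integral_nonneg fun x => (Real.exp_pos _).le
          · intro i _
            rw [(aux_integrable _ (hlt i)).2]
            exact aux_mgf _ _ hlK0 (habs i)
      _ = Real.exp (l * ∑ i, d i + l ^ 2 * F ^ 2 / (1 - 2 * (l * K))) := by
          rw [← Real.exp_sum, Finset.sum_add_distrib, ← Finset.mul_sum, ← Finset.sum_div, ← hdF,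
            Finset.mul_sum (s := Finset.univ) (f := fun i => d i ^ 2)]
          simp only [mul_pow]
      _ ≤ Real.exp (-t) := by
          apply Real.exp_le_exp.mpr
          have h1 := mul_le_mul_of_nonneg_left htr hl0.le
          have h2 : l * -(2 * F * r + 2 * K * t) + l ^ 2 * F ^ 2 / (1 - 2 * (l * K)) = -t := by
            rw [hlK, hl, hrt]; field_simp; ring
          linarith
  exact aux_chernoff _ _ l _ hl0 hint hmgf

lemma aux_matrix {n : ℕ} (A : Matrix (Fin n) (Fin n) ℝ) (hA : A.IsHermitian) (t : ℝ) (ht : 0 < t)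
    (htr : A.trace ≤ -(2 * frobNorm A * Real.sqrt t + 2 * specNorm A * t)) :
    (Measure.pi fun _ : Fin n => gaussianReal 0 1) {s | 0 < s ⬝ᵥ A.mulVec s} ≤
      ENNReal.ofReal (Real.exp (-t)) := by
  set b := hA.eigenvectorBasis with hb
  set d := hA.eigenvalues with hd
  have hmul : ∀ j, A *ᵥ (b j).ofLp = d j • (b j).ofLp := hA.mulVec_eigenvectorBasis
  have horth : ∀ i j, (b i).ofLp ⬝ᵥ (b j).ofLp = if i = j then 1 else 0 := by
    intro i j
    have := orthonormal_iff_ite.mp b.orthonormal i j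
    rw [← this, EuclideanSpace.inner_eq_star_dotProduct, dotProduct_comm]
    simp
  have hquad : ∀ x : Fin n → ℝ, (∑ i, x i • b i).ofLp ⬝ᵥ A.mulVec (∑ i, x i • b i).ofLp =
      ∑ i, d i * x i ^ 2 := by
    intro x
    have e : (∑ i, x i • b i).ofLp = ∑ i, x i • (b i).ofLp := by
      simp [WithLp.ofLp_sum]
    rw [e, Matrix.mulVec_sum, sum_dotProduct]
    simp only [Matrix.mulVec_smul, hmul, dotProduct_sum, smul_dotProduct, dotProduct_smul, horth]
    simp
    refine Finset.sum_congr rfl fun i _ => by ring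
  have hmeas : MeasurableSet {s : Fin n → ℝ | 0 < s ⬝ᵥ A.mulVec s} := by
    apply measurableSet_lt measurable_const
    apply Continuous.measurable
    fun_prop
  rw [← aux_rot b, Measure.map_apply (by fun_prop) hmeas]
  have hset : (fun x : Fin n → ℝ => (∑ i, x i • b i).ofLp) ⁻¹' {s | 0 < s ⬝ᵥ A.mulVec s} =
      {x | 0 < ∑ i, d i * x i ^ 2} := by
    ext x
    simp only [Set.mem_preimage, Set.mem_setOf_eq, hquad]
  rw [hset]
  apply aux_diag d (frobNorm A) (specNorm A) t ht (Real.sqrt_nonneg _) (norm_nonneg _)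
  · intro i
    have h := (Matrix.toEuclideanCLM (𝕜 := ℝ) A).le_opNorm (b i)
    have e : Matrix.toEuclideanCLM (𝕜 := ℝ) A (b i) = d i • b i := by
      ext k
      have := congrFun (hmul i) k
      simpa using this
    rw [e, norm_smul, b.orthonormal.1 i] at h
    simpa [specNorm] using h
  · have h1 : (A * A).trace = ∑ i, d i ^ 2 := by
      have hs := hA.spectral_theorem
      have : A * A = Unitary.conjStarAlgAut ℝ _ hA.eigenvectorUnitary
          (diagonal (RCLike.ofReal ∘ hA.eigenvalues) * diagonal (RCLike.ofReal ∘ hA.eigenvalues)) := by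
        rw [map_mul, ← hs]
      rw [this, Unitary.conjStarAlgAut_apply, Matrix.trace_mul_cycle, ← mul_assoc]
      simp [Matrix.trace, hd, pow_two]
    rw [← h1, frobNorm, Real.sq_sqrt (by positivity)]
    simp only [Matrix.trace, Matrix.diag, Matrix.mul_apply]
    refine Finset.sum_congr rfl fun i _ => Finset.sum_congr rfl fun j _ => ?_
    have := hA.apply i j
    simp at this
    rw [this, pow_two]
  · have := hA.trace_eq_sum_eigenvalues
    simp at this
    rw [← hd] at this
    rw [← this]
    exact htr

/-- Hanson–Wright-based tail bound (probabilistic core of Theorem 3): for a standard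
Gaussian vector `s`, with probability at least `1 - γ` one has `sᵀQs ≤ Θ (sᵀΩs)`,
where `Q = Ω^{1/2}(I - vvᵀ)Ω^{1/2}` and `Θ = 1 - vᵀΩv/tr(Ω) + Δ`. -/
theorem stmt_13 (n : ℕ) (hn : 1 ≤ n) (Ω S : Matrix (Fin n) (Fin n) ℝ)
    (hΩ : Ω.PosSemidef) (htr : 0 < Ω.trace) (hS : S.PosSemidef) (hSS : S * S = Ω)
    (v : Fin n → ℝ) (hv : v ⬝ᵥ v = 1)
    (γ : ℝ) (hγ0 : 0 < γ) (hγ1 : γ < 1) (Δ : ℝ)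
    (hΔ : (2 * frobNorm ((S * (1 - Matrix.vecMulVec v v) * S) -
              (1 - (v ⬝ᵥ Ω.mulVec v) / Ω.trace + Δ) • Ω) * Real.sqrt (Real.log (1 / γ)) +
            2 * specNorm ((S * (1 - Matrix.vecMulVec v v) * S) -
              (1 - (v ⬝ᵥ Ω.mulVec v) / Ω.trace + Δ) • Ω) * Real.log (1 / γ)) / Ω.trace ≤ Δ) :
    ENNReal.ofReal (1 - γ) ≤
      (Measure.pi fun _ : Fin n => gaussianReal 0 1)
        {s | s ⬝ᵥ ((S * (1 - Matrix.vecMulVec v v) * S).mulVec s) ≤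
          (1 - (v ⬝ᵥ Ω.mulVec v) / Ω.trace + Δ) * (s ⬝ᵥ (Ω.mulVec s))} := by
  set Θ := 1 - (v ⬝ᵥ Ω.mulVec v) / Ω.trace + Δ with hΘ
  set Q := S * (1 - Matrix.vecMulVec v v) * S with hQ
  have hSH : Sᵀ = S := by simpa using hS.isHermitian.eq
  have hΩH : Ωᵀ = Ω := by simpa using hΩ.isHermitian.eq
  have hQT : Qᵀ = Q := by
    rw [hQ]
    simp [Matrix.transpose_mul, Matrix.transpose_sub, hSH, Matrix.transpose_vecMulVec, mul_assoc]
  have hA : (Q - Θ • Ω).IsHermitian := by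
    rw [Matrix.IsHermitian, Matrix.conjTranspose_eq_transpose_of_trivial]
    simp [hQT, hΩH]
  have hQtr : Q.trace = Ω.trace - v ⬝ᵥ Ω.mulVec v := by
    rw [hQ, Matrix.trace_mul_comm, ← mul_assoc, hSS, mul_sub, Matrix.trace_sub, mul_one,
      Matrix.mul_vecMulVec, Matrix.trace_vecMulVec, dotProduct_comm]
  have htrA : (Q - Θ • Ω).trace = -(Δ * Ω.trace) := by
    rw [Matrix.trace_sub, Matrix.trace_smul, hQtr, hΘ, smul_eq_mul]
    field_simp
    ring
  have ht : 0 < Real.log (1 / γ) := Real.log_pos (by rw [lt_div_iff₀ hγ0]; linarith)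
  rw [div_le_iff₀ htr] at hΔ
  have hmain := aux_matrix (Q - Θ • Ω) hA _ ht (by rw [htrA]; linarith)
  have hexp : Real.exp (-Real.log (1 / γ)) = γ := by
    rw [one_div, Real.log_inv, neg_neg, Real.exp_log hγ0]
  rw [hexp] at hmain
  have hset : {s : Fin n → ℝ | s ⬝ᵥ (Q.mulVec s) ≤ Θ * (s ⬝ᵥ (Ω.mulVec s))} =
      {s | 0 < s ⬝ᵥ (Q - Θ • Ω).mulVec s}ᶜ := by
    ext s
    simp only [Set.mem_setOf_eq, Set.mem_compl_iff, Matrix.sub_mulVec, Matrix.smul_mulVec,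
      dotProduct_sub, dotProduct_smul, smul_eq_mul, not_lt, sub_nonpos]
  have hmeas : MeasurableSet {s : Fin n → ℝ | 0 < s ⬝ᵥ (Q - Θ • Ω).mulVec s} := by
    apply measurableSet_lt measurable_const
    apply Continuous.measurable
    fun_prop
  rw [hset, prob_compl_eq_one_sub hmeas, ENNReal.ofReal_sub _ hγ0.le, ENNReal.ofReal_one]
  exact tsub_le_tsub_left hmain 1
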